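/- arXiv:2108.13224 — 2 statements merged into one kernel-verified Lean document; each statement's English description precedes it below -/
import Mathlib

section
/- Let κ satisfy the energy, consistency, and domination principles, and let A ⊂ X. Then for all μ, ν ∈ E⁺ the symmetry relation κ(μ^A, ν) = κ(μ, ν^A) holds. Moreover, this relation determines the inner balayage uniquely: if μ ∈ E⁺ and ξ ∈ E⁺ satisfy κ(ξ, ν) = κ(μ, ν^A) for all ν ∈ E⁺, then ξ = μ^A. -/
open MeasureTheory Filter Topology Set
open scoped ENNReal NNReal

namespace Balayage

variable {X : Type*} [TopologicalSpace X] [T2Space X] [LocallyCompactSpace X]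
  [MeasurableSpace X] [BorelSpace X]

/-- The potential `κμ(x) := ∫ κ(x,y) dμ(y)`. -/
noncomputable def pot (κ : X → X → ℝ≥0∞) (μ : Measure X) (x : X) : ℝ≥0∞ :=
  ∫⁻ y, κ x y ∂μ

/-- The mutual energy `κ(μ,ν) := ∬ κ(x,y) d(μ⊗ν)(x,y)`. -/
noncomputable def energy (κ : X → X → ℝ≥0∞) (μ ν : Measure X) : ℝ≥0∞ :=
  ∫⁻ x, pot κ ν x ∂μ

/-- A positive Radon measure: locally finite and inner regular. -/
def IsRadon (μ : Measure X) : Prop :=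
  μ.InnerRegular ∧ IsLocallyFiniteMeasure μ

/-- `E⁺`: the positive Radon measures of finite energy. -/
def Eplus (κ : X → X → ℝ≥0∞) : Set (Measure X) :=
  {μ | IsRadon μ ∧ energy κ μ μ < ⊤}

/-- `μ` is concentrated on `A`: `A` is `μ`-measurable and `X∖A` is locally `μ`-negligible. -/
def ConcOn (μ : Measure X) (A : Set X) : Prop :=
  NullMeasurableSet A μ ∧ ∀ K : Set X, IsCompact K → μ (Aᶜ ∩ K) = 0

/-- `E⁺_A`: measures of finite energy concentrated on `A`. -/
def EplusOn (κ : X → X → ℝ≥0∞) (A : Set X) : Set (Measure X) :=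
  {μ ∈ Eplus κ | ConcOn μ A}

/-- The inner capacity `c_*(A)`. -/
noncomputable def innerCap (κ : X → X → ℝ≥0∞) (A : Set X) : ℝ≥0∞ :=
  (⨅ μ ∈ {μ ∈ EplusOn κ A | μ Set.univ = 1}, energy κ μ μ)⁻¹

/-- `P` holds nearly everywhere on `A`: the set where it fails has inner capacity zero. -/
def NEOn (κ : X → X → ℝ≥0∞) (A : Set X) (P : X → Prop) : Prop :=
  innerCap κ {x | x ∈ A ∧ ¬ P x} = 0

/-- The outer capacity `c^*(A)`. -/
noncomputable def outerCap (κ : X → X → ℝ≥0∞) (A : Set X) : ℝ≥0∞ :=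
  ⨅ D ∈ {D : Set X | IsOpen D ∧ A ⊆ D}, innerCap κ D

/-- `P` holds quasi-everywhere on `A`: the set where it fails has outer capacity zero. -/
def QEOn (κ : X → X → ℝ≥0∞) (A : Set X) (P : X → Prop) : Prop :=
  outerCap κ {x | x ∈ A ∧ ¬ P x} = 0

/-- The class `Λ_{A,μ}` of measures `ν ∈ E⁺` with `κν ≥ κμ` n.e. on `A`. -/
def InnerLam (κ : X → X → ℝ≥0∞) (A : Set X) (μ : Measure X) : Set (Measure X) :=
  {ν ∈ Eplus κ | NEOn κ A (fun x => pot κ μ x ≤ pot κ ν x)}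

/-- The class `Λ*_{A,μ}` of measures `ν ∈ E⁺` with `κν ≥ κμ` q.e. on `A`. -/
def OuterLam (κ : X → X → ℝ≥0∞) (A : Set X) (μ : Measure X) : Set (Measure X) :=
  {ν ∈ Eplus κ | QEOn κ A (fun x => pot κ μ x ≤ pot κ ν x)}

/-- `b` is the inner balayage `μ^A`: the measure of minimal potential in `Λ_{A,μ}`. -/
def IsInnerBal (κ : X → X → ℝ≥0∞) (A : Set X) (μ b : Measure X) : Prop :=
  b ∈ InnerLam κ A μ ∧ ∀ ν ∈ InnerLam κ A μ, ∀ x, pot κ b x ≤ pot κ ν x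

/-- `b` is the outer balayage `μ^{*A}`: the measure of minimal potential in `Λ*_{A,μ}`. -/
def IsOuterBal (κ : X → X → ℝ≥0∞) (A : Set X) (μ b : Measure X) : Prop :=
  b ∈ OuterLam κ A μ ∧ ∀ ν ∈ OuterLam κ A μ, ∀ x, pot κ b x ≤ pot κ ν x

/-- The strong (energy) distance `‖μ − ν‖`. -/
noncomputable def strDist (κ : X → X → ℝ≥0∞) (μ ν : Measure X) : ℝ :=
  Real.sqrt ((energy κ μ μ).toReal - 2 * (energy κ μ ν).toReal + (energy κ ν ν).toReal)

/-- The energy principle (strict positive definiteness). -/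
def EnergyPrinciple (κ : X → X → ℝ≥0∞) : Prop :=
  ∀ μ ∈ Eplus κ, ∀ ν ∈ Eplus κ,
    2 * energy κ μ ν ≤ energy κ μ μ + energy κ ν ν ∧
      (2 * energy κ μ ν = energy κ μ μ + energy κ ν ν → μ = ν)

/-- Vague convergence of a net of measures along a filter. -/
def VagueConv {ι : Type*} (F : Filter ι) (m : ι → Measure X) (ν : Measure X) : Prop :=
  ∀ f : X → ℝ, Continuous f → HasCompactSupport f →
    Tendsto (fun i => ∫ x, f x ∂(m i)) F (nhds (∫ x, f x ∂ν))

/-- A net of measures is strong Cauchy (for the energy metric) along a filter. -/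
def StrongCauchy (κ : X → X → ℝ≥0∞) {ι : Type*} (F : Filter ι) (m : ι → Measure X) : Prop :=
  ∀ ε : ℝ, 0 < ε → ∃ s ∈ F, ∀ i ∈ s, ∀ j ∈ s, strDist κ (m i) (m j) < ε

/-- The consistency principle: every strong Cauchy net in `E⁺` converges strongly
to each of its vague limit points. -/
def Consistent (κ : X → X → ℝ≥0∞) : Prop :=
  ∀ (ι : Type) (F : Filter ι) (m : ι → Measure X), F.NeBot →
    (∀ i, m i ∈ Eplus κ) → StrongCauchy κ F m →
    ∀ ν : Measure X, (∃ G : Filter ι, G ≤ F ∧ G.NeBot ∧ VagueConv G m ν) →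
      Tendsto (fun i => strDist κ (m i) ν) F (nhds 0)

/-- The domination principle. -/
def Domination (κ : X → X → ℝ≥0∞) : Prop :=
  ∀ μ ∈ Eplus κ, ∀ ν ∈ Eplus κ,
    (∀ᵐ x ∂μ, pot κ μ x ≤ pot κ ν x) → ∀ x, pot κ μ x ≤ pot κ ν x

/-- A kernel: symmetric and lower semicontinuous. -/
structure IsKernel (κ : X → X → ℝ≥0∞) : Prop where
  symm : ∀ x y, κ x y = κ y x
  lsc : LowerSemicontinuous (Function.uncurry κ)

/-- `E'_A`: the strong closure of `E⁺_A` within `E⁺`. -/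
def EclosOn (κ : X → X → ℝ≥0∞) (A : Set X) : Set (Measure X) :=
  {ν ∈ Eplus κ | ∀ ε : ℝ, 0 < ε → ∃ μ ∈ EplusOn κ A, strDist κ ν μ < ε}

/-- The (real-valued) potential of the signed measure `λ = lp − lm`. -/
noncomputable def spot (κ : X → X → ℝ≥0∞) (lp lm : Measure X) (x : X) : ℝ :=
  (pot κ lp x).toReal - (pot κ lm x).toReal

/-- Assumption (A2): every `f ∈ C_c(X)` is the limit, uniformly with supports in one fixed
compact set, of a sequence of potentials of signed measures of finite energy that are
continuous and compactly supported. -/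
def A2 (κ : X → X → ℝ≥0∞) : Prop :=
  ∀ f : X → ℝ, Continuous f → HasCompactSupport f →
    ∃ (K : Set X) (lp lm : ℕ → Measure X), IsCompact K ∧ tsupport f ⊆ K ∧
      (∀ j, lp j ∈ Eplus κ ∧ lm j ∈ Eplus κ) ∧
      (∀ j x, pot κ (lp j) x ≠ ⊤ ∨ pot κ (lm j) x ≠ ⊤) ∧
      (∀ j, Continuous (spot κ (lp j) (lm j))) ∧
      (∀ j, tsupport (spot κ (lp j) (lm j)) ⊆ K) ∧
      TendstoUniformly (fun j => spot κ (lp j) (lm j)) f atTop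

/-! ### Integration of directed families of lower semicontinuous functions -/

omit [T2Space X] [LocallyCompactSpace X] [BorelSpace X] in
/-- Inner regular measures are `τ`-additive along directed families of open sets, also relative
to a measurable set. -/
lemma measure_le_iSup_inter_of_directed {μ : Measure X} [μ.InnerRegular] {ι : Type*} [Nonempty ι]
    {U : ι → Set X} (hU : ∀ i, IsOpen (U i)) (hd : Directed (· ⊆ ·) U) {E : Set X}
    (hE : MeasurableSet E) (hEU : E ⊆ ⋃ i, U i) : μ E ≤ ⨆ i, μ (E ∩ U i) := by
  refine le_of_forall_lt fun r hr => ?_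
  obtain ⟨K, hKE, hK, hrK⟩ := hE.exists_lt_isCompact hr
  obtain ⟨i, hi⟩ := hK.elim_directed_cover U hU (hKE.trans hEU) hd
  exact hrK.trans_le ((measure_mono (subset_inter hKE hi)).trans
    (le_iSup (fun i => μ (E ∩ U i)) i))

omit [T2Space X] [LocallyCompactSpace X] in
/-- Monotone convergence for directed families of lower semicontinuous functions. -/
lemma lintegral_iSup_of_directed_lsc {μ : Measure X} [μ.InnerRegular] {ι : Type*} [Nonempty ι]
    {f : ι → X → ℝ≥0∞} (hf : ∀ i, LowerSemicontinuous (f i)) (hd : Directed (· ≤ ·) f) :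
    ∫⁻ x, ⨆ i, f i x ∂μ = ⨆ i, ∫⁻ x, f i x ∂μ := by
  refine le_antisymm ?_ (iSup_lintegral_le _)
  rw [lintegral_eq_nnreal]
  refine iSup₂_le fun φ hφ => ENNReal.le_of_forall_lt_one_mul_le fun r hr => ?_
  let U : ℝ≥0 → ι → Set X := fun c i => {x | r * c < f i x}
  have hUo : ∀ c i, IsOpen (U c i) := fun c i => (hf i).isOpen_preimage _
  have hkey : ∀ c ∈ φ.range, r * (c * μ (φ ⁻¹' {c})) ≤
      ⨆ i, r * c * μ (φ ⁻¹' {c} ∩ U c i) := by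
    intro c _
    rw [← ENNReal.mul_iSup, ← mul_assoc]
    rcases eq_or_ne c 0 with rfl | hc
    · simp
    gcongr
    refine measure_le_iSup_inter_of_directed (hUo c) ?_ (φ.measurableSet_fiber c) ?_
    · intro i j
      obtain ⟨k, hik, hjk⟩ := hd i j
      exact ⟨k, fun x hx => lt_of_lt_of_le hx (hik x), fun x hx => lt_of_lt_of_le hx (hjk x)⟩
    · intro x hx
      have hx' : φ x = c := hx
      have h1 : r * c < ⨆ i, f i x := by
        refine lt_of_lt_of_le ?_ (hφ x)
        rw [hx']
        have : (c : ℝ≥0∞) ≠ 0 := by simpa using hc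
        simpa using ENNReal.mul_lt_mul_left this ENNReal.coe_ne_top hr
      obtain ⟨i, hi⟩ := lt_iSup_iff.1 h1
      exact mem_iUnion.2 ⟨i, hi⟩
  have hsum : (φ.map ((↑) : ℝ≥0 → ℝ≥0∞)).lintegral μ
      = ∑ c ∈ φ.range, c * μ (φ ⁻¹' {c}) := SimpleFunc.map_lintegral _ _
  rw [hsum, Finset.mul_sum]
  refine (Finset.sum_le_sum hkey).trans ?_
  rw [ENNReal.finsetSum_iSup]
  · refine iSup_mono fun i => ?_
    calc ∑ c ∈ φ.range, r * c * μ (φ ⁻¹' {c} ∩ U c i)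
        ≤ ∑ c ∈ φ.range, ∫⁻ x in φ ⁻¹' {c}, f i x ∂μ := by
          refine Finset.sum_le_sum fun c _ => ?_
          calc r * c * μ (φ ⁻¹' {c} ∩ U c i)
              = ∫⁻ x in φ ⁻¹' {c} ∩ U c i, r * c ∂μ := by simp
            _ ≤ ∫⁻ x in φ ⁻¹' {c} ∩ U c i, f i x ∂μ :=
                setLIntegral_mono' ((φ.measurableSet_fiber c).inter (hUo c i).measurableSet)
                  fun x hx => le_of_lt hx.2
            _ ≤ _ := lintegral_mono_set inter_subset_left
      _ = ∫⁻ x in ⋃ c ∈ φ.range, φ ⁻¹' {c}, f i x ∂μ := by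
          rw [lintegral_biUnion_finset _ (fun c _ => φ.measurableSet_fiber c)]
          intro a _ b _ hab
          exact Disjoint.preimage _ (by simpa using hab)
      _ ≤ _ := setLIntegral_le_lintegral _ _
  · intro i j
    obtain ⟨k, hik, hjk⟩ := hd i j
    refine ⟨k, fun c => ⟨?_, ?_⟩⟩
    · gcongr
      exact fun x hx => lt_of_lt_of_le hx (hik x)
    · gcongr
      exact fun x hx => lt_of_lt_of_le hx (hjk x)

/-- The nonnegative continuous compactly supported functions below `g`. -/
abbrev Minorant {Y : Type*} [TopologicalSpace Y] (g : Y → ℝ≥0∞) : Type _ :=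
  {f : Y → ℝ // Continuous f ∧ HasCompactSupport f ∧ (∀ y, 0 ≤ f y) ∧
    ∀ y, ENNReal.ofReal (f y) ≤ g y}

section Minorant

variable {Y : Type*} [TopologicalSpace Y]

instance (g : Y → ℝ≥0∞) : Nonempty (Minorant g) :=
  ⟨⟨0, continuous_zero, HasCompactSupport.zero, by simp, by simp⟩⟩

lemma minorant_directed (g : Y → ℝ≥0∞) (f₁ f₂ : Minorant g) :
    ∃ f : Minorant g, (∀ y, f₁.1 y ≤ f.1 y) ∧ ∀ y, f₂.1 y ≤ f.1 y := by
  obtain ⟨f₁, c₁, s₁, p₁, l₁⟩ := f₁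
  obtain ⟨f₂, c₂, s₂, p₂, l₂⟩ := f₂
  refine ⟨⟨fun y => max (f₁ y) (f₂ y), c₁.max c₂, ?_, fun y => le_max_of_le_left (p₁ y),
    fun y => ?_⟩, fun y => le_max_left _ _, fun y => le_max_right _ _⟩
  · exact s₁.sup s₂
  · rw [ENNReal.ofReal_max]
    exact max_le (l₁ y) (l₂ y)

/-- A lower semicontinuous function is the supremum of its minorants. -/
lemma iSup_minorant [T2Space Y] [LocallyCompactSpace Y] {g : Y → ℝ≥0∞}
    (hg : LowerSemicontinuous g) (y : Y) :
    ⨆ f : Minorant g, ENNReal.ofReal (f.1 y) = g y := by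
  refine le_antisymm (iSup_le fun f => f.2.2.2.2 y) (le_of_forall_lt fun t ht => ?_)
  obtain ⟨s, hts, hsg⟩ := exists_between ht
  have hs : s ≠ ⊤ := hsg.ne_top
  have hU : IsOpen {z | s < g z} := hg.isOpen_preimage s
  obtain ⟨f, hf1, hf0, hfc, hf⟩ := exists_continuous_one_zero_of_isCompact
    (isCompact_singleton (x := y)) hU.isClosed_compl (by simpa using hsg)
  have hfy : f y = 1 := hf1 rfl
  let F : Minorant g := ⟨fun z => s.toReal * f z, by fun_prop, hfc.mul_left,
    fun z => mul_nonneg ENNReal.toReal_nonneg (hf z).1, fun z => by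
      by_cases hz : s < g z
      · rw [ENNReal.ofReal_mul ENNReal.toReal_nonneg, ENNReal.ofReal_toReal hs]
        refine le_trans ?_ hz.le
        exact mul_le_of_le_one_right' (by simpa using (hf z).2)
      · have : f z = 0 := hf0 hz
        simp [this]⟩
  refine hts.trans_le (le_trans ?_ (le_iSup _ F))
  simp [F, hfy, ENNReal.ofReal_toReal hs]

end Minorant

lemma lintegral_eq_iSup_minorant {μ : Measure X} [μ.InnerRegular] {g : X → ℝ≥0∞}
    (hg : LowerSemicontinuous g) :
    ∫⁻ x, g x ∂μ = ⨆ f : Minorant g, ∫⁻ x, ENNReal.ofReal (f.1 x) ∂μ := by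
  rw [← lintegral_iSup_of_directed_lsc]
  · simp_rw [iSup_minorant hg]
  · intro f
    exact (ENNReal.continuous_ofReal.comp f.2.1).lowerSemicontinuous
  · intro f₁ f₂
    obtain ⟨f, h₁, h₂⟩ := minorant_directed g f₁ f₂
    exact ⟨f, fun y => ENNReal.ofReal_le_ofReal (h₁ y), fun y => ENNReal.ofReal_le_ofReal (h₂ y)⟩

omit [T2Space X] [LocallyCompactSpace X] in
lemma lintegral_ofReal_eq {μ : Measure X} [IsLocallyFiniteMeasure μ] {f : X → ℝ}
    (hc : Continuous f) (hs : HasCompactSupport f) (h0 : ∀ x, 0 ≤ f x) :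
    ∫⁻ x, ENNReal.ofReal (f x) ∂μ = ENNReal.ofReal (∫ x, f x ∂μ) :=
  (ofReal_integral_eq_lintegral_ofReal (hc.integrable_of_hasCompactSupport hs)
    (Eventually.of_forall h0)).symm

/-! ### Potentials and energies -/

section Kernel

variable {κ : X → X → ℝ≥0∞}

lemma pot_eq_iSup (hker : IsKernel κ) {μ : Measure X} (hμ : IsRadon μ) (x : X) :
    pot κ μ x = ⨆ f : Minorant (Function.uncurry κ), ∫⁻ y, ENNReal.ofReal (f.1 (x, y)) ∂μ := by
  have := hμ.1
  rw [← lintegral_iSup_of_directed_lsc]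
  · refine lintegral_congr fun y => ?_
    rw [iSup_minorant hker.lsc (x, y)]; rfl
  · intro f
    have := f.2.1
    exact (ENNReal.continuous_ofReal.comp (by fun_prop)).lowerSemicontinuous
  · intro f₁ f₂
    obtain ⟨f, h₁, h₂⟩ := minorant_directed _ f₁ f₂
    exact ⟨f, fun y => ENNReal.ofReal_le_ofReal (h₁ _), fun y => ENNReal.ofReal_le_ofReal (h₂ _)⟩

omit [LocallyCompactSpace X] [MeasurableSpace X] [BorelSpace X] in
lemma hasCompactSupport_slice {f : X × X → ℝ} (hf : HasCompactSupport f) (x : X) :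
    HasCompactSupport fun y => f (x, y) := by
  refine HasCompactSupport.intro (hf.isCompact.image continuous_snd) fun y hy => ?_
  by_contra h
  exact hy ⟨(x, y), subset_tsupport _ h, rfl⟩

omit [LocallyCompactSpace X] in
lemma continuous_lintegral_slice {μ : Measure X} (hμ : IsRadon μ) {f : X × X → ℝ}
    (hc : Continuous f) (hs : HasCompactSupport f) (h0 : ∀ z, 0 ≤ f z) :
    Continuous fun x => ∫⁻ y, ENNReal.ofReal (f (x, y)) ∂μ := by
  have := hμ.2
  have h1 : (fun x => ∫⁻ y, ENNReal.ofReal (f (x, y)) ∂μ)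
      = fun x => ENNReal.ofReal (∫ y, f (x, y) ∂μ) := by
    funext x
    exact lintegral_ofReal_eq (by fun_prop) (hasCompactSupport_slice hs x) fun y => h0 _
  rw [h1]
  refine ENNReal.continuous_ofReal.comp ?_
  rw [← continuousOn_univ]
  refine continuousOn_integral_of_compact_support (hs.isCompact.image continuous_snd)
    (by fun_prop) ?_
  intro x y _ hy
  by_contra h
  exact hy ⟨(x, y), subset_tsupport _ h, rfl⟩

lemma lowerSemicontinuous_pot (hker : IsKernel κ) {μ : Measure X} (hμ : IsRadon μ) :
    LowerSemicontinuous (pot κ μ) := by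
  have : pot κ μ = fun x => ⨆ f : Minorant (Function.uncurry κ),
      ∫⁻ y, ENNReal.ofReal (f.1 (x, y)) ∂μ := funext (pot_eq_iSup hker hμ)
  rw [this]
  exact lowerSemicontinuous_iSup fun f =>
    (continuous_lintegral_slice hμ f.2.1 f.2.2.1 f.2.2.2.1).lowerSemicontinuous

lemma measurable_pot (hker : IsKernel κ) {μ : Measure X} (hμ : IsRadon μ) :
    Measurable (pot κ μ) := (lowerSemicontinuous_pot hker hμ).measurable

lemma energy_eq_iSup (hker : IsKernel κ) {μ ν : Measure X} (hμ : IsRadon μ) (hν : IsRadon ν) :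
    energy κ μ ν = ⨆ f : Minorant (Function.uncurry κ),
      ∫⁻ x, ∫⁻ y, ENNReal.ofReal (f.1 (x, y)) ∂ν ∂μ := by
  have := hμ.1
  rw [← lintegral_iSup_of_directed_lsc]
  · exact lintegral_congr fun x => pot_eq_iSup hker hν x
  · exact fun f => (continuous_lintegral_slice hν f.2.1 f.2.2.1 f.2.2.2.1).lowerSemicontinuous
  · intro f₁ f₂
    obtain ⟨f, h₁, h₂⟩ := minorant_directed _ f₁ f₂
    exact ⟨f, fun x => lintegral_mono fun y => ENNReal.ofReal_le_ofReal (h₁ _),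
      fun x => lintegral_mono fun y => ENNReal.ofReal_le_ofReal (h₂ _)⟩

omit [LocallyCompactSpace X] in
lemma lintegral_lintegral_swap_minorant {μ ν : Measure X} (hμ : IsRadon μ) (hν : IsRadon ν)
    {f : X × X → ℝ} (hc : Continuous f) (hs : HasCompactSupport f) (h0 : ∀ z, 0 ≤ f z) :
    ∫⁻ x, ∫⁻ y, ENNReal.ofReal (f (x, y)) ∂ν ∂μ
      = ∫⁻ y, ∫⁻ x, ENNReal.ofReal (f (x, y)) ∂μ ∂ν := by
  have := hμ.2
  have := hν.2
  have hs' : HasCompactSupport (f ∘ Prod.swap) := hs.comp_homeomorph (Homeomorph.prodComm X X)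
  have aux : ∀ {g : X × X → ℝ} {μ ν : Measure X} [IsLocallyFiniteMeasure μ]
      [IsLocallyFiniteMeasure ν], Continuous g → HasCompactSupport g → (∀ z, 0 ≤ g z) →
      ∫⁻ x, ∫⁻ y, ENNReal.ofReal (g (x, y)) ∂ν ∂μ
        = ENNReal.ofReal (∫ x, ∫ y, g (x, y) ∂ν ∂μ) := by
    intro g μ ν _ _ hc hs h0
    have h1 : ∀ x, ∫⁻ y, ENNReal.ofReal (g (x, y)) ∂ν = ENNReal.ofReal (∫ y, g (x, y) ∂ν) :=
      fun x => lintegral_ofReal_eq (by fun_prop) (hasCompactSupport_slice hs x) fun y => h0 _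
    simp_rw [h1]
    refine lintegral_ofReal_eq ?_ ?_ fun x => integral_nonneg fun y => h0 _
    · rw [← continuousOn_univ]
      refine continuousOn_integral_of_compact_support (hs.isCompact.image continuous_snd)
        (by fun_prop) ?_
      intro x y _ hy
      by_contra h
      exact hy ⟨(x, y), subset_tsupport _ h, rfl⟩
    · refine HasCompactSupport.intro (hs.isCompact.image continuous_fst) fun x hx => ?_
      have : ∀ y, g (x, y) = 0 := by
        intro y
        by_contra h
        exact hx ⟨(x, y), subset_tsupport _ h, rfl⟩
      simp [this]
  rw [aux hc hs h0]
  have := aux (μ := ν) (ν := μ) (hc.comp continuous_swap) hs' fun z => h0 _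
  simp only [Function.comp_apply, Prod.swap_prod_mk] at this
  rw [this, integral_integral_swap_of_hasCompactSupport (f := fun x y => f (x, y)) hc hs]

lemma energy_comm (hker : IsKernel κ) {μ ν : Measure X} (hμ : IsRadon μ) (hν : IsRadon ν) :
    energy κ μ ν = energy κ ν μ := by
  have hs : ∀ f : X × X → ℝ, HasCompactSupport f → HasCompactSupport (f ∘ Prod.swap) :=
    fun f hf => hf.comp_homeomorph (Homeomorph.prodComm X X)
  rw [energy_eq_iSup hker hμ hν, energy_eq_iSup hker hν hμ]
  let e : Minorant (Function.uncurry κ) → Minorant (Function.uncurry κ) := fun f =>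
    ⟨f.1 ∘ Prod.swap, f.2.1.comp continuous_swap, hs _ f.2.2.1, fun z => f.2.2.2.1 _, fun z => by
      have := f.2.2.2.2 z.swap
      rwa [Function.uncurry_apply_pair, hker.symm] at this⟩
  have he : Function.Surjective e := fun f => ⟨e f, Subtype.ext (funext fun _ => rfl)⟩
  rw [← he.iSup_comp]
  refine iSup_congr fun f => ?_
  exact (lintegral_lintegral_swap_minorant hν hμ f.2.1 f.2.2.1 f.2.2.2.1).symm

end Kernel

/-! ### Vague limits -/

omit [LocallyCompactSpace X] in
/-- Every regular measure has an inner regular version with the same values on compact sets. -/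
lemma exists_isRadon_restrict_eq (ν : Measure X) [ν.Regular] [WeaklyLocallyCompactSpace X] :
    ∃ b : Measure X, IsRadon b ∧ ∀ K, IsCompact K → b.restrict K = ν.restrict K := by
  let m : ∀ s : Set X, MeasurableSet s → ℝ≥0∞ := fun s _ =>
    ⨆ K : TopologicalSpace.Compacts X, ν (s ∩ K)
  let b : Measure X := Measure.ofMeasurable m (by simp [m]) (by
    intro f hf hd
    have h1 : ∀ K : TopologicalSpace.Compacts X, ν ((⋃ i, f i) ∩ K) = ∑' i, ν (f i ∩ K) := by
      intro K
      rw [iUnion_inter, measure_iUnion]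
      · exact fun i j hij => (hd hij).mono inter_subset_left inter_subset_left
      · exact fun i => (hf i).inter K.isCompact.measurableSet
    simp only [m, h1, ENNReal.tsum_eq_iSup_sum]
    rw [iSup_comm]
    refine iSup_congr fun s => ?_
    rw [ENNReal.finsetSum_iSup]
    intro K L
    refine ⟨K ⊔ L, fun a => ⟨?_, ?_⟩⟩ <;> gcongr <;> simp)
  have hb : ∀ s, MeasurableSet s → b s = ⨆ K : TopologicalSpace.Compacts X, ν (s ∩ K) :=
    fun s hs => Measure.ofMeasurable_apply s hs
  have hbK : ∀ s, MeasurableSet s → ∀ K, IsCompact K → b (s ∩ K) = ν (s ∩ K) := by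
    intro s hs K hK
    rw [hb _ (hs.inter hK.measurableSet)]
    refine le_antisymm (iSup_le fun L => measure_mono inter_subset_left) ?_
    refine le_iSup_of_le ⟨K, hK⟩ ?_
    simp [inter_assoc]
  refine ⟨b, ⟨⟨?_⟩, ?_⟩, ?_⟩
  · intro s hs r hr
    rw [hb s hs] at hr
    obtain ⟨K, hrK⟩ := lt_iSup_iff.1 hr
    obtain ⟨L, hLs, hL, hrL⟩ :=
      (hs.inter K.isCompact.measurableSet).exists_lt_isCompact_of_ne_top
        (ne_top_of_le_ne_top K.isCompact.measure_ne_top (measure_mono inter_subset_right)) hrK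
    refine ⟨L, hLs.trans inter_subset_left, hL, ?_⟩
    have := hbK univ MeasurableSet.univ L hL
    rw [univ_inter] at this
    rwa [this]
  · refine ⟨fun x => ?_⟩
    obtain ⟨K, hK, hx⟩ := exists_compact_mem_nhds x
    refine ⟨K, hx, ?_⟩
    have := hbK univ MeasurableSet.univ K hK
    rw [univ_inter] at this
    rw [this]
    exact hK.measure_lt_top
  · intro K hK
    ext s hs
    rw [Measure.restrict_apply hs, Measure.restrict_apply hs, hbK s hs K hK]

/-- Vague compactness: a sequence of measures that is bounded on compact sets has a vague limit
along every ultrafilter. -/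
lemma exists_vagueConv (G : Ultrafilter ℕ) {m : ℕ → Measure X} (hm : ∀ n, IsRadon (m n))
    (hb : ∀ K, IsCompact K → ∃ C : ℝ≥0, ∀ n, m n K ≤ C) :
    ∃ b : Measure X, IsRadon b ∧ VagueConv (G : Filter ℕ) m b := by
  have hloc : ∀ n, IsLocallyFiniteMeasure (m n) := fun n => (hm n).2
  have hlim : ∀ f : CompactlySupportedContinuousMap X ℝ, ∃ l : ℝ,
      Tendsto (fun n => ∫ x, f x ∂(m n)) G (𝓝 l) := by
    intro f
    obtain ⟨C, hC⟩ := hb _ f.hasCompactSupport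
    obtain ⟨M, hM⟩ := f.hasCompactSupport.exists_bound_of_continuous f.continuous
    have hbd : ∀ n, ∫ x, f x ∂(m n) ∈ Metric.closedBall (0 : ℝ) (max M 0 * C) := by
      intro n
      have hfin : m n (tsupport f) < ⊤ := (hC n).trans_lt ENNReal.coe_lt_top
      rw [mem_closedBall_zero_iff, ← setIntegral_eq_integral_of_forall_compl_eq_zero
        (s := tsupport f) fun x hx => image_eq_zero_of_notMem_tsupport hx]
      refine (norm_setIntegral_le_of_norm_le_const hfin
        fun x _ => (hM x).trans (le_max_left M 0)).trans ?_
      gcongr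
      exact ENNReal.toReal_mono ENNReal.coe_ne_top (hC n)
    obtain ⟨l, -, hl⟩ := (isCompact_closedBall (0 : ℝ) (max M 0 * C)).ultrafilter_le_nhds
      (G.map fun n => ∫ x, f x ∂(m n)) (by
        rw [le_principal_iff]
        exact Filter.mem_map.2 (univ_mem' hbd))
    exact ⟨l, hl⟩
  choose L hL using hlim
  have hint : ∀ (f : CompactlySupportedContinuousMap X ℝ) n, Integrable f (m n) := fun f n =>
    f.continuous.integrable_of_hasCompactSupport f.hasCompactSupport
  let Λ : CompactlySupportedContinuousMap X ℝ →ₗ[ℝ] ℝ :=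
    { toFun := L
      map_add' := fun f g => by
        refine tendsto_nhds_unique (hL (f + g)) (((hL f).add (hL g)).congr fun n => ?_)
        exact (integral_add (hint f n) (hint g n)).symm
      map_smul' := fun c f => by
        refine tendsto_nhds_unique (hL (c • f)) (((hL f).const_smul c).congr fun n => ?_)
        exact (integral_smul c _).symm }
  let Λ' := PositiveLinearMap.mk₀ Λ fun f hf =>
    ge_of_tendsto (hL f) (Eventually.of_forall fun n =>
      integral_nonneg (CompactlySupportedContinuousMap.le_def.1 hf))
  obtain ⟨b, hbR, hbK⟩ := exists_isRadon_restrict_eq (RealRMK.rieszMeasure Λ')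
  refine ⟨b, hbR, fun f hc hs => ?_⟩
  have h1 : ∫ x, f x ∂b = ∫ x, f x ∂(RealRMK.rieszMeasure Λ') := by
    rw [← setIntegral_eq_integral_of_forall_compl_eq_zero
        (s := tsupport f) (fun x hx => image_eq_zero_of_notMem_tsupport hx), hbK _ hs,
      setIntegral_eq_integral_of_forall_compl_eq_zero
        (s := tsupport f) (fun x hx => image_eq_zero_of_notMem_tsupport hx)]
  let F : CompactlySupportedContinuousMap X ℝ := ⟨⟨f, hc⟩, hs⟩
  have h2 : ∫ x, f x ∂(RealRMK.rieszMeasure Λ') = L F := RealRMK.integral_rieszMeasure Λ' F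
  rw [h1, h2]
  exact hL F

/-- Integrals of lower semicontinuous functions are vaguely lower semicontinuous. -/
lemma lintegral_le_of_vagueConv {G : Filter ℕ} [G.NeBot] {m : ℕ → Measure X} {b : Measure X}
    (hm : ∀ n, IsRadon (m n)) (hb : IsRadon b) (h : VagueConv G m b) {g : X → ℝ≥0∞}
    (hg : LowerSemicontinuous g) {c : ℝ≥0∞} (hc : ∀ n, ∫⁻ x, g x ∂(m n) ≤ c) :
    ∫⁻ x, g x ∂b ≤ c := by
  have := hb.1
  have := hb.2
  have hloc : ∀ n, IsLocallyFiniteMeasure (m n) := fun n => (hm n).2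
  rw [lintegral_eq_iSup_minorant hg]
  refine iSup_le fun f => ?_
  rw [lintegral_ofReal_eq f.2.1 f.2.2.1 f.2.2.2.1]
  refine le_of_tendsto ((ENNReal.continuous_ofReal.tendsto _).comp (h f.1 f.2.1 f.2.2.1))
    (Eventually.of_forall fun n => ?_)
  simp only [Function.comp_apply]
  rw [← lintegral_ofReal_eq f.2.1 f.2.2.1 f.2.2.2.1]
  exact (lintegral_mono f.2.2.2.2).trans (hc n)

/-! ### Radon measures -/

omit [T2Space X] [LocallyCompactSpace X] [BorelSpace X] in
lemma isRadon_zero : IsRadon (0 : Measure X) := ⟨inferInstance, inferInstance⟩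

omit [T2Space X] [LocallyCompactSpace X] [BorelSpace X] in
lemma IsRadon.add {μ ν : Measure X} (hμ : IsRadon μ) (hν : IsRadon ν) : IsRadon (μ + ν) := by
  have := hμ.1
  have := hν.1
  have := hμ.2
  have := hν.2
  refine ⟨inferInstance, ⟨fun x => ?_⟩⟩
  obtain ⟨s, hs, hμs⟩ := μ.finiteAt_nhds x
  obtain ⟨t, ht, hνt⟩ := ν.finiteAt_nhds x
  refine ⟨s ∩ t, inter_mem hs ht, ?_⟩
  rw [Measure.add_apply]
  exact ENNReal.add_lt_top.2 ⟨(measure_mono inter_subset_left).trans_lt hμs,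
    (measure_mono inter_subset_right).trans_lt hνt⟩

omit [T2Space X] [LocallyCompactSpace X] [BorelSpace X] in
lemma IsRadon.smul {μ : Measure X} (hμ : IsRadon μ) (c : ℝ≥0) : IsRadon (c • μ) := by
  have := hμ.1
  have := hμ.2
  refine ⟨inferInstance, ⟨fun x => ?_⟩⟩
  obtain ⟨s, hs, hμs⟩ := μ.finiteAt_nhds x
  exact ⟨s, hs, by
    rw [Measure.smul_apply]
    exact ENNReal.mul_lt_top ENNReal.coe_lt_top hμs⟩

omit [LocallyCompactSpace X] in
lemma IsRadon.restrict {μ : Measure X} (hμ : IsRadon μ) {K : Set X} (hK : IsCompact K) :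
    IsRadon (μ.restrict K) := by
  have := hμ.1
  have := hμ.2
  refine ⟨⟨fun s hs r hr => ?_⟩, inferInstance⟩
  rw [Measure.restrict_apply hs] at hr
  obtain ⟨L, hLs, hL, hrL⟩ := (hs.inter hK.measurableSet).exists_lt_isCompact hr
  refine ⟨L, hLs.trans inter_subset_left, hL, ?_⟩
  rwa [Measure.restrict_apply hL.measurableSet, inter_eq_left.2 (hLs.trans inter_subset_right)]

omit [LocallyCompactSpace X] in
lemma isRadon_dirac (x : X) : IsRadon (Measure.dirac x) := by
  refine ⟨⟨fun s hs r hr => ?_⟩, inferInstance⟩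
  by_cases hx : x ∈ s
  · refine ⟨{x}, by simpa using hx, isCompact_singleton, ?_⟩
    simpa [Measure.dirac_apply' x hs, hx] using hr
  · simp [Measure.dirac_apply' x hs, hx] at hr

section Energy

variable {κ : X → X → ℝ≥0∞}

omit [TopologicalSpace X] [T2Space X] [LocallyCompactSpace X] [BorelSpace X] in
lemma energy_add_left (μ₁ μ₂ ν : Measure X) :
    energy κ (μ₁ + μ₂) ν = energy κ μ₁ ν + energy κ μ₂ ν := lintegral_add_measure _ _ _

omit [TopologicalSpace X] [T2Space X] [LocallyCompactSpace X] [BorelSpace X] in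
lemma energy_smul_left (c : ℝ≥0) (μ ν : Measure X) :
    energy κ (c • μ) ν = c * energy κ μ ν := lintegral_smul_measure _ _

lemma energy_add_right (hker : IsKernel κ) {μ ν₁ ν₂ : Measure X} (hμ : IsRadon μ)
    (h₁ : IsRadon ν₁) (h₂ : IsRadon ν₂) :
    energy κ μ (ν₁ + ν₂) = energy κ μ ν₁ + energy κ μ ν₂ := by
  rw [energy_comm hker hμ (h₁.add h₂), energy_add_left, energy_comm hker h₁ hμ,
    energy_comm hker h₂ hμ]

lemma energy_smul_right (hker : IsKernel κ) {μ ν : Measure X} (hμ : IsRadon μ)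
    (hν : IsRadon ν) (c : ℝ≥0) : energy κ μ (c • ν) = c * energy κ μ ν := by
  rw [energy_comm hker hμ (hν.smul c), energy_smul_left, energy_comm hker hν hμ]

omit [T2Space X] [LocallyCompactSpace X] [BorelSpace X] in
lemma energy_lt_top (hE : EnergyPrinciple κ) {μ ν : Measure X} (hμ : μ ∈ Eplus κ)
    (hν : ν ∈ Eplus κ) : energy κ μ ν < ⊤ := by
  have h1 := (hE μ hμ ν hν).1.trans_lt (ENNReal.add_lt_top.2 ⟨hμ.2, hν.2⟩)
  refine lt_of_le_of_lt ?_ h1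
  exact le_mul_of_one_le_left' (by norm_num)

omit [T2Space X] [LocallyCompactSpace X] [BorelSpace X] in
lemma zero_mem_Eplus : (0 : Measure X) ∈ Eplus κ := ⟨isRadon_zero, by simp [energy]⟩

lemma add_mem_Eplus (hker : IsKernel κ) (hE : EnergyPrinciple κ) {μ ν : Measure X}
    (hμ : μ ∈ Eplus κ) (hν : ν ∈ Eplus κ) : μ + ν ∈ Eplus κ := by
  refine ⟨hμ.1.add hν.1, ?_⟩
  rw [energy_add_left, energy_add_right hker hμ.1 hμ.1 hν.1,
    energy_add_right hker hν.1 hμ.1 hν.1]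
  simp [hμ.2, hν.2, energy_lt_top hE hμ hν, energy_lt_top hE hν hμ]

lemma smul_mem_Eplus (hker : IsKernel κ) {μ : Measure X}
    (hμ : μ ∈ Eplus κ) (c : ℝ≥0) : c • μ ∈ Eplus κ := by
  refine ⟨hμ.1.smul c, ?_⟩
  rw [energy_smul_left, energy_smul_right hker hμ.1 hμ.1]
  exact ENNReal.mul_lt_top ENNReal.coe_lt_top (ENNReal.mul_lt_top ENNReal.coe_lt_top hμ.2)

omit [LocallyCompactSpace X] in
lemma restrict_mem_Eplus {μ : Measure X} (hμ : μ ∈ Eplus κ) {K : Set X} (hK : IsCompact K) :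
    μ.restrict K ∈ Eplus κ := by
  refine ⟨hμ.1.restrict hK, lt_of_le_of_lt ?_ hμ.2⟩
  refine (setLIntegral_le_lintegral _ _).trans (lintegral_mono fun x => ?_)
  exact setLIntegral_le_lintegral _ _

/-- The real-valued mutual energy. -/
noncomputable def realEnergy (κ : X → X → ℝ≥0∞) (μ ν : Measure X) : ℝ := (energy κ μ ν).toReal

/-- The squared energy distance. -/
noncomputable def sqDist (κ : X → X → ℝ≥0∞) (μ ν : Measure X) : ℝ :=
  realEnergy κ μ μ - 2 * realEnergy κ μ ν + realEnergy κ ν ν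

omit [TopologicalSpace X] [T2Space X] [LocallyCompactSpace X] [BorelSpace X] in
lemma strDist_eq (μ ν : Measure X) : strDist κ μ ν = √(sqDist κ μ ν) := rfl

omit [TopologicalSpace X] [T2Space X] [LocallyCompactSpace X] [BorelSpace X] in
lemma realEnergy_nonneg (μ ν : Measure X) : 0 ≤ realEnergy κ μ ν := ENNReal.toReal_nonneg

lemma realEnergy_comm (hker : IsKernel κ) {μ ν : Measure X} (hμ : μ ∈ Eplus κ)
    (hν : ν ∈ Eplus κ) : realEnergy κ μ ν = realEnergy κ ν μ := by
  rw [realEnergy, energy_comm hker hμ.1 hν.1, realEnergy]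

omit [T2Space X] [LocallyCompactSpace X] [BorelSpace X] in
lemma realEnergy_add_left (hE : EnergyPrinciple κ) {μ₁ μ₂ ν : Measure X} (h₁ : μ₁ ∈ Eplus κ)
    (h₂ : μ₂ ∈ Eplus κ) (hν : ν ∈ Eplus κ) :
    realEnergy κ (μ₁ + μ₂) ν = realEnergy κ μ₁ ν + realEnergy κ μ₂ ν := by
  rw [realEnergy, energy_add_left, ENNReal.toReal_add (energy_lt_top hE h₁ hν).ne
    (energy_lt_top hE h₂ hν).ne, realEnergy, realEnergy]

omit [TopologicalSpace X] [T2Space X] [LocallyCompactSpace X] [BorelSpace X] in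
lemma realEnergy_smul_left (c : ℝ≥0) (μ ν : Measure X) :
    realEnergy κ (c • μ) ν = c * realEnergy κ μ ν := by
  rw [realEnergy, energy_smul_left, ENNReal.toReal_mul, ENNReal.coe_toReal, realEnergy]

lemma realEnergy_add_right (hker : IsKernel κ) (hE : EnergyPrinciple κ) {μ₁ μ₂ ν : Measure X}
    (h₁ : μ₁ ∈ Eplus κ) (h₂ : μ₂ ∈ Eplus κ) (hν : ν ∈ Eplus κ) :
    realEnergy κ ν (μ₁ + μ₂) = realEnergy κ ν μ₁ + realEnergy κ ν μ₂ := by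
  rw [realEnergy_comm hker hν (add_mem_Eplus hker hE h₁ h₂), realEnergy_add_left hE h₁ h₂ hν,
    realEnergy_comm hker h₁ hν, realEnergy_comm hker h₂ hν]

lemma realEnergy_smul_right (hker : IsKernel κ) (c : ℝ≥0) {μ ν : Measure X}
    (hμ : μ ∈ Eplus κ) (hν : ν ∈ Eplus κ) :
    realEnergy κ μ (c • ν) = c * realEnergy κ μ ν := by
  rw [realEnergy_comm hker hμ (smul_mem_Eplus hker hν c), realEnergy_smul_left,
    realEnergy_comm hker hν hμ]

omit [T2Space X] [LocallyCompactSpace X] [BorelSpace X] in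
lemma sqDist_nonneg (hE : EnergyPrinciple κ) {μ ν : Measure X} (hμ : μ ∈ Eplus κ)
    (hν : ν ∈ Eplus κ) : 0 ≤ sqDist κ μ ν := by
  have h := ENNReal.toReal_mono (ENNReal.add_lt_top.2 ⟨hμ.2, hν.2⟩).ne (hE μ hμ ν hν).1
  rw [ENNReal.toReal_mul, ENNReal.toReal_add hμ.2.ne hν.2.ne, ENNReal.toReal_ofNat] at h
  unfold sqDist realEnergy
  linarith

lemma sqDist_add_smul_left (hker : IsKernel κ) (hE : EnergyPrinciple κ) {μ ν τ : Measure X}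
    (hμ : μ ∈ Eplus κ) (hν : ν ∈ Eplus κ) (hτ : τ ∈ Eplus κ) (t : ℝ≥0) :
    sqDist κ (μ + t • τ) ν = sqDist κ μ ν + 2 * t * (realEnergy κ μ τ - realEnergy κ ν τ)
      + t ^ 2 * realEnergy κ τ τ := by
  have htτ := smul_mem_Eplus hker hτ t
  have hs := add_mem_Eplus hker hE hμ htτ
  simp only [sqDist, realEnergy_add_left hE hμ htτ hs, realEnergy_add_left hE hμ htτ hν,
    realEnergy_add_right hker hE hμ htτ hμ, realEnergy_smul_left,
    realEnergy_add_right hker hE hμ htτ hτ, realEnergy_smul_right hker t hμ hτ,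
    realEnergy_smul_right hker t hτ hτ, realEnergy_comm hker hτ hμ, realEnergy_comm hker hτ hν]
  ring

lemma sqDist_comm (hker : IsKernel κ) {μ ν : Measure X}
    (hμ : μ ∈ Eplus κ) (hν : ν ∈ Eplus κ) : sqDist κ μ ν = sqDist κ ν μ := by
  simp only [sqDist, realEnergy_comm hker hμ hν]
  ring

/-- The Cauchy–Schwarz inequality for differences of measures. -/
lemma sq_realEnergy_sub_le (hker : IsKernel κ) (hE : EnergyPrinciple κ) {μ ν τ : Measure X}
    (hμ : μ ∈ Eplus κ) (hν : ν ∈ Eplus κ) (hτ : τ ∈ Eplus κ) :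
    (realEnergy κ μ τ - realEnergy κ ν τ) ^ 2 ≤ sqDist κ μ ν * realEnergy κ τ τ := by
  have key : ∀ t : ℝ, 0 ≤ realEnergy κ τ τ * (t * t)
      + (2 * (realEnergy κ μ τ - realEnergy κ ν τ)) * t + sqDist κ μ ν := by
    intro t
    rcases le_total 0 t with ht | ht
    · lift t to ℝ≥0 using ht
      have h := sqDist_nonneg hE
        (add_mem_Eplus hker hE hμ (smul_mem_Eplus hker hτ t)) hν
      rw [sqDist_add_smul_left hker hE hμ hν hτ] at h
      linarith
    · obtain ⟨s, hs⟩ : ∃ s : ℝ≥0, (s : ℝ) = -t := ⟨⟨-t, by linarith⟩, rfl⟩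
      have h := sqDist_nonneg hE
        (add_mem_Eplus hker hE hν (smul_mem_Eplus hker hτ s)) hμ
      rw [sqDist_add_smul_left hker hE hν hμ hτ, sqDist_comm hker hν hμ, hs] at h
      linarith
  have := discrim_le_zero key
  rw [discrim] at this
  linarith

lemma tendsto_realEnergy (hker : IsKernel κ) (hE : EnergyPrinciple κ) {σ : ℕ → Measure X}
    {b τ : Measure X} (hσ : ∀ n, σ n ∈ Eplus κ) (hb : b ∈ Eplus κ) (hτ : τ ∈ Eplus κ)
    (h : Tendsto (fun n => sqDist κ (σ n) b) atTop (𝓝 0)) :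
    Tendsto (fun n => realEnergy κ (σ n) τ) atTop (𝓝 (realEnergy κ b τ)) := by
  rw [tendsto_iff_norm_sub_tendsto_zero]
  have h1 : Tendsto (fun n => √(sqDist κ (σ n) b * realEnergy κ τ τ)) atTop (𝓝 0) := by
    have := (h.mul_const (realEnergy κ τ τ)).sqrt
    simpa using this
  refine squeeze_zero (fun n => norm_nonneg _) (fun n => ?_) h1
  exact Real.abs_le_sqrt (sq_realEnergy_sub_le hker hE (hσ n) hb hτ)

lemma tendsto_realEnergy_self (hker : IsKernel κ) (hE : EnergyPrinciple κ) {σ : ℕ → Measure X}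
    {b : Measure X} (hσ : ∀ n, σ n ∈ Eplus κ) (hb : b ∈ Eplus κ)
    (h : Tendsto (fun n => sqDist κ (σ n) b) atTop (𝓝 0)) :
    Tendsto (fun n => realEnergy κ (σ n) (σ n)) atTop (𝓝 (realEnergy κ b b)) := by
  have h1 := tendsto_realEnergy hker hE hσ hb hb h
  have h2 := (h.add (h1.const_mul 2)).sub_const (realEnergy κ b b)
  have h3 : (0 : ℝ) + 2 * realEnergy κ b b - realEnergy κ b b = realEnergy κ b b := by ring
  rw [h3] at h2
  refine h2.congr fun n => ?_
  rw [sqDist]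
  ring

/-! ### Boundedness and strong limits -/

omit [LocallyCompactSpace X] in
lemma kernel_diag_pos (hE : EnergyPrinciple κ) (x : X) : 0 < κ x x := by
  rw [pos_iff_ne_zero]
  intro h
  have hδ : energy κ (Measure.dirac x) (Measure.dirac x) = 0 := by
    simp [energy, pot, lintegral_dirac, h]
  have h1 : Measure.dirac x ∈ Eplus κ := ⟨isRadon_dirac x, by simp [hδ]⟩
  have h2 : Measure.dirac x = 0 :=
    (hE _ h1 0 zero_mem_Eplus).2 (by rw [hδ]; simp [energy, pot])
  have h3 : (Measure.dirac x) univ = 0 := by rw [h2]; simp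
  simp at h3

omit [LocallyCompactSpace X] in
/-- Measures of bounded energy are uniformly bounded on compact sets. -/
lemma exists_measure_le_of_energy_le (hker : IsKernel κ) (hE : EnergyPrinciple κ) (M : ℝ≥0)
    {K : Set X} (hK : IsCompact K) :
    ∃ C : ℝ≥0, ∀ σ : Measure X, energy κ σ σ ≤ M → σ K ≤ C := by
  refine hK.induction_on (p := fun s => ∃ C : ℝ≥0, ∀ σ : Measure X, energy κ σ σ ≤ M → σ s ≤ C)
    ⟨0, by simp⟩ ?_ ?_ ?_
  · rintro s t hst ⟨C, hC⟩
    exact ⟨C, fun σ hσ => (measure_mono hst).trans (hC σ hσ)⟩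
  · rintro s t ⟨C, hC⟩ ⟨D, hD⟩
    refine ⟨C + D, fun σ hσ => (measure_union_le s t).trans ?_⟩
    rw [ENNReal.coe_add]
    exact add_le_add (hC σ hσ) (hD σ hσ)
  · intro x _
    obtain ⟨c, hc0, hcx⟩ := exists_between (kernel_diag_pos hE x)
    have hct : c ≠ ⊤ := hcx.ne_top
    have hnhds : {z : X × X | c < Function.uncurry κ z} ∈ 𝓝 (x, x) := hker.lsc (x, x) c hcx
    rw [nhds_prod_eq, mem_prod_self_iff] at hnhds
    obtain ⟨V, hV, hVc⟩ := hnhds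
    obtain ⟨U, hUV, hU, hxU⟩ := mem_nhds_iff.1 hV
    refine ⟨U, mem_nhdsWithin_of_mem_nhds (hU.mem_nhds hxU), (max 1 (M / c)).toNNReal, ?_⟩
    intro σ hσ
    have hfin : max 1 (M / c) ≠ ⊤ :=
      (max_lt ENNReal.one_lt_top (ENNReal.div_lt_top ENNReal.coe_ne_top hc0.ne')).ne
    rw [ENNReal.coe_toNNReal hfin]
    have h1 : c * σ U * σ U ≤ M := by
      refine le_trans ?_ hσ
      calc c * σ U * σ U = ∫⁻ _ in U, c * σ U ∂σ := by simp
        _ ≤ ∫⁻ x in U, pot κ σ x ∂σ := by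
          refine setLIntegral_mono' hU.measurableSet fun x hx => ?_
          calc c * σ U = ∫⁻ _ in U, c ∂σ := by simp
            _ ≤ ∫⁻ y in U, κ x y ∂σ := by
              refine setLIntegral_mono' hU.measurableSet fun y hy => ?_
              exact le_of_lt (hVc (mk_mem_prod (hUV hx) (hUV hy)))
            _ ≤ _ := setLIntegral_le_lintegral _ _
        _ ≤ _ := setLIntegral_le_lintegral _ _
    rcases le_total (σ U) 1 with h | h
    · exact le_max_of_le_left h
    · refine le_max_of_le_right ?_
      rw [ENNReal.le_div_iff_mul_le (Or.inl hc0.ne') (Or.inl hct)]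
      refine le_trans ?_ h1
      rw [mul_comm]
      exact le_mul_of_one_le_right' h

/-- A vague limit of a sequence of bounded energy has finite energy. -/
lemma mem_Eplus_of_vagueConv (hker : IsKernel κ) (hE : EnergyPrinciple κ) {G : Filter ℕ} [G.NeBot]
    {σ : ℕ → Measure X} (hσ : ∀ n, σ n ∈ Eplus κ) {M : ℝ≥0} (hM : ∀ n, energy κ (σ n) (σ n) ≤ M)
    {b : Measure X} (hb : IsRadon b) (h : VagueConv G σ b) : b ∈ Eplus κ := by
  have hR : ∀ n, IsRadon (σ n) := fun n => (hσ n).1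
  have h0 : ∀ m n, energy κ (σ m) (σ n) ≤ M := by
    intro m n
    have h1 := (hE _ (hσ m) _ (hσ n)).1.trans (add_le_add (hM m) (hM n))
    rw [← two_mul] at h1
    exact (ENNReal.mul_le_mul_iff_right (by norm_num) (by norm_num)).1 h1
  have h1 : ∀ m, energy κ b (σ m) ≤ M := fun m =>
    lintegral_le_of_vagueConv hR hb h (lowerSemicontinuous_pot hker (hR m)) fun n => h0 n m
  have h2 : energy κ b b ≤ M :=
    lintegral_le_of_vagueConv hR hb h (lowerSemicontinuous_pot hker hb) fun n => by
      have := h1 n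
      rwa [energy_comm hker hb (hR n)] at this
  exact ⟨hb, h2.trans_lt ENNReal.coe_lt_top⟩

/-- Minimizing sequences for the distance to a convex cone converge strongly and, along an
ultrafilter, vaguely. -/
lemma exists_limit_of_minimizing (hker : IsKernel κ) (hE : EnergyPrinciple κ) (hC : Consistent κ)
    {C : Set (Measure X)} (hCE : C ⊆ Eplus κ) (hadd : ∀ σ ∈ C, ∀ τ ∈ C, σ + τ ∈ C)
    (hsmul : ∀ (c : ℝ≥0), ∀ σ ∈ C, c • σ ∈ C) {μ : Measure X} (hμ : μ ∈ Eplus κ)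
    {σ : ℕ → Measure X} (hσ : ∀ n, σ n ∈ C) {d : ℝ} (hd : ∀ τ ∈ C, d ≤ sqDist κ μ τ)
    (hlim : Tendsto (fun n => sqDist κ μ (σ n)) atTop (𝓝 d)) :
    ∃ b ∈ Eplus κ, (∃ G : Ultrafilter ℕ, VagueConv (G : Filter ℕ) σ b) ∧
      Tendsto (fun n => sqDist κ (σ n) b) atTop (𝓝 0) := by
  have hσE : ∀ n, σ n ∈ Eplus κ := fun n => hCE (hσ n)
  have hpar : ∀ m n, sqDist κ (σ m) (σ n)
      ≤ 2 * (sqDist κ μ (σ m) - d) + 2 * (sqDist κ μ (σ n) - d) := by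
    intro m n
    have hs := add_mem_Eplus hker hE (hσE m) (hσE n)
    have h := hd _ (hsmul (1 / 2) _ (hadd _ (hσ m) _ (hσ n)))
    have hcoe : (((1 / 2 : ℝ≥0)) : ℝ) = 1 / 2 := by norm_num
    simp only [sqDist, realEnergy_smul_right hker _ hμ hs, realEnergy_smul_left,
      realEnergy_smul_right hker _ hs hs, realEnergy_add_left hE (hσE m) (hσE n) hs,
      realEnergy_add_right hker hE (hσE m) (hσE n) hμ,
      realEnergy_add_right hker hE (hσE m) (hσE n) (hσE m),
      realEnergy_add_right hker hE (hσE m) (hσE n) (hσE n), hcoe,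
      realEnergy_comm hker (hσE n) (hσE m)] at h ⊢
    linarith
  have hbound : ∀ n, realEnergy κ (σ n) (σ n) ≤ 2 * sqDist κ μ (σ n) + 2 * realEnergy κ μ μ := by
    intro n
    have h := sqDist_nonneg hE (smul_mem_Eplus hker hμ 2) (hσE n)
    simp only [sqDist, realEnergy_smul_left, realEnergy_smul_right hker _ hμ hμ,
      NNReal.coe_ofNat] at h ⊢
    linarith
  obtain ⟨B, hB⟩ := hlim.bddAbove_range
  obtain ⟨M, hM⟩ : ∃ M : ℝ≥0, ∀ n, energy κ (σ n) (σ n) ≤ M := by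
    refine ⟨(2 * B + 2 * realEnergy κ μ μ).toNNReal, fun n => ?_⟩
    have hBn : sqDist κ μ (σ n) ≤ B := hB ⟨n, rfl⟩
    rw [← ENNReal.ofReal_toReal (hσE n).2.ne]
    exact ENNReal.ofReal_le_ofReal ((hbound n).trans (by linarith))
  obtain ⟨b, hbR, hb⟩ := exists_vagueConv (hyperfilter ℕ) (m := σ) (fun n => (hσE n).1)
    fun K hK => by
      obtain ⟨D, hD⟩ := exists_measure_le_of_energy_le hker hE M hK
      exact ⟨D, fun n => hD _ (hM n)⟩
  have hbE := mem_Eplus_of_vagueConv hker hE hσE hM hbR hb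
  refine ⟨b, hbE, ⟨_, hb⟩, ?_⟩
  have hcauchy : StrongCauchy κ atTop σ := by
    intro ε hε
    have hev : ∀ᶠ n in atTop, sqDist κ μ (σ n) < d + ε ^ 2 / 4 :=
      hlim.eventually_lt_const (by nlinarith)
    refine ⟨_, hev, fun m hm n hn => ?_⟩
    rw [strDist_eq, Real.sqrt_lt' hε]
    have := hpar m n
    simp only [mem_ofPred_eq] at hm hn
    linarith
  have hstr := hC ℕ atTop σ inferInstance hσE hcauchy b
    ⟨hyperfilter ℕ, Nat.hyperfilter_le_atTop, inferInstance, hb⟩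
  have := hstr.pow 2
  simp only [ne_eq, OfNat.ofNat_ne_zero, not_false_eq_true, zero_pow] at this
  refine this.congr fun n => ?_
  rw [strDist_eq, Real.sq_sqrt (sqDist_nonneg hE (hσE n) hbE)]

end Energy

section Swept

variable {κ : X → X → ℝ≥0∞}

/-- The measures of finite energy carried by a compact subset of `A`. -/
def compactlyCarried (κ : X → X → ℝ≥0∞) (A : Set X) : Set (Measure X) :=
  {σ ∈ Eplus κ | ∃ K ⊆ A, IsCompact K ∧ σ Kᶜ = 0}

omit [T2Space X] [LocallyCompactSpace X] [BorelSpace X] in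
lemma compactlyCarried_subset (A : Set X) : compactlyCarried κ A ⊆ Eplus κ := fun _ h => h.1

omit [T2Space X] [LocallyCompactSpace X] [BorelSpace X] in
lemma compactlyCarried_mono {A B : Set X} (h : A ⊆ B) :
    compactlyCarried κ A ⊆ compactlyCarried κ B := fun _ ⟨hσ, K, hK, hKc, h0⟩ =>
  ⟨hσ, K, hK.trans h, hKc, h0⟩

omit [T2Space X] [LocallyCompactSpace X] [BorelSpace X] in
lemma zero_mem_compactlyCarried (A : Set X) : (0 : Measure X) ∈ compactlyCarried κ A :=
  ⟨zero_mem_Eplus, ∅, empty_subset _, isCompact_empty, by simp⟩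

lemma add_mem_compactlyCarried (hker : IsKernel κ) (hE : EnergyPrinciple κ) {A : Set X} :
    ∀ σ ∈ compactlyCarried κ A, ∀ τ ∈ compactlyCarried κ A, σ + τ ∈ compactlyCarried κ A := by
  rintro σ ⟨hσ, K, hKA, hK, hσK⟩ τ ⟨hτ, L, hLA, hL, hτL⟩
  refine ⟨add_mem_Eplus hker hE hσ hτ, K ∪ L, union_subset hKA hLA, hK.union hL, ?_⟩
  rw [Measure.add_apply, measure_mono_null (compl_subset_compl.2 subset_union_left) hσK,
    measure_mono_null (compl_subset_compl.2 subset_union_right) hτL, add_zero]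

lemma smul_mem_compactlyCarried (hker : IsKernel κ) {A : Set X} :
    ∀ (c : ℝ≥0), ∀ σ ∈ compactlyCarried κ A, c • σ ∈ compactlyCarried κ A := by
  rintro c σ ⟨hσ, K, hKA, hK, hσK⟩
  exact ⟨smul_mem_Eplus hker hσ c, K, hKA, hK, by simp [hσK]⟩

/-- A measure carried by a compact subset of `A` does not charge measurable sets of inner
capacity zero. -/
lemma NEOn.ae (hker : IsKernel κ) {A : Set X} {P : X → Prop} (h : NEOn κ A P)
    (hP : MeasurableSet {x | ¬ P x}) {τ : Measure X} (hτ : τ ∈ compactlyCarried κ A) :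
    ∀ᵐ x ∂τ, P x := by
  obtain ⟨hτE, K, hKA, hK, hτK⟩ := hτ
  have := hτE.1.1
  have := hτE.1.2
  rw [ae_iff]
  by_contra hne
  have hne' : 0 < τ ({x | ¬ P x} ∩ K) := by
    rw [measure_inter_conull hτK]
    exact pos_iff_ne_zero.2 hne
  obtain ⟨L, hLs, hL, hL0⟩ := (hP.inter hK.measurableSet).exists_lt_isCompact hne'
  have hLfin : τ L ≠ ⊤ := hL.measure_ne_top
  let c : ℝ≥0 := (τ L)⁻¹.toNNReal
  have hc : (c : ℝ≥0∞) = (τ L)⁻¹ := ENNReal.coe_toNNReal (ENNReal.inv_ne_top.2 hL0.ne')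
  let σ : Measure X := c • τ.restrict L
  have hσE : σ ∈ Eplus κ := smul_mem_Eplus hker (restrict_mem_Eplus hτE hL) c
  have hσ1 : σ univ = 1 := by
    change (c : ℝ≥0∞) * (τ.restrict L) univ = 1
    rw [Measure.restrict_apply_univ, hc, ENNReal.inv_mul_cancel hL0.ne' hLfin]
  have hσ0 : σ {x | x ∈ A ∧ ¬ P x}ᶜ = 0 := by
    refine measure_mono_null (t := Lᶜ)
      (compl_subset_compl.2 fun x hx => ⟨hKA (hLs hx).2, (hLs hx).1⟩) ?_
    change (c : ℝ≥0∞) * (τ.restrict L) Lᶜ = 0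
    rw [Measure.restrict_apply hL.measurableSet.compl]
    simp
  have hconc : ConcOn σ {x | x ∈ A ∧ ¬ P x} :=
    ⟨(NullMeasurableSet.of_null hσ0).of_compl, fun K _ => measure_mono_null inter_subset_left hσ0⟩
  have hinf : (⨅ μ ∈ {μ ∈ EplusOn κ {x | x ∈ A ∧ ¬ P x} | μ univ = 1}, energy κ μ μ) < ⊤ :=
    (iInf₂_le σ ⟨⟨hσE, hconc⟩, hσ1⟩).trans_lt hσE.2
  rw [NEOn, innerCap, ENNReal.inv_eq_zero] at h
  exact hinf.ne h

omit [LocallyCompactSpace X] in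
/-- A set of positive inner capacity carries a nonzero measure of finite energy. -/
lemma exists_ae_not_of_not_NEOn {A : Set X} {P : X → Prop} (h : ¬ NEOn κ A P) :
    ∃ τ ∈ compactlyCarried κ A, τ ≠ 0 ∧ ∀ᵐ x ∂τ, ¬ P x := by
  rw [NEOn, innerCap, ENNReal.inv_eq_zero] at h
  replace h := lt_top_iff_ne_top.2 h
  obtain ⟨σ, hσ⟩ := iInf_lt_iff.1 h
  obtain ⟨⟨⟨hσE, hmeas, hnull⟩, hσ1⟩, -⟩ := iInf_lt_iff.1 hσ
  have := hσE.1.1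
  obtain ⟨K, -, hK, hK0⟩ := MeasurableSet.univ.exists_lt_isCompact (μ := σ) (r := 0) (by simp [hσ1])
  obtain ⟨N, hNsub, hN, hNae⟩ := hmeas.exists_measurable_subset_ae_eq
  have hNK : 0 < σ (N ∩ K) := by
    rw [measure_congr (hNae.inter (ae_eq_refl K)), inter_comm,
      measure_inter_conull' (by rw [sdiff_eq, inter_comm]; exact hnull K hK)]
    exact hK0
  obtain ⟨L, hLs, hL, hL0⟩ := (hN.inter hK.measurableSet).exists_lt_isCompact hNK
  have hLN : ∀ x ∈ L, x ∈ A ∧ ¬ P x := fun x hx => hNsub (hLs hx).1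
  refine ⟨σ.restrict L, ⟨restrict_mem_Eplus hσE hL, L, fun x hx => (hLN x hx).1, hL, ?_⟩, ?_, ?_⟩
  · rw [Measure.restrict_apply hL.measurableSet.compl]
    simp
  · intro h0
    rw [Measure.restrict_eq_zero] at h0
    exact hL0.ne' h0
  · exact (ae_restrict_iff' hL.measurableSet).2 (Eventually.of_forall fun x hx => (hLN x hx).2)

lemma measurableSet_not_pot_le (hker : IsKernel κ) {μ ν : Measure X} (hμ : IsRadon μ)
    (hν : IsRadon ν) : MeasurableSet {x | ¬ pot κ μ x ≤ pot κ ν x} :=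
  (measurableSet_le (measurable_pot hker hμ) (measurable_pot hker hν)).compl

/-- If the energies against all compactly carried measures dominate, so do the potentials, nearly
everywhere. -/
lemma NEOn_of_realEnergy_le (hker : IsKernel κ) (hE : EnergyPrinciple κ) {A : Set X}
    {μ b : Measure X} (hμ : μ ∈ Eplus κ) (hb : b ∈ Eplus κ)
    (h : ∀ τ ∈ compactlyCarried κ A, realEnergy κ μ τ ≤ realEnergy κ b τ) :
    NEOn κ A fun x => pot κ μ x ≤ pot κ b x := by
  by_contra hne
  obtain ⟨τ, hτ, hτ0, hae⟩ := exists_ae_not_of_not_NEOn hne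
  have hlt : energy κ τ b < energy κ τ μ :=
    lintegral_strict_mono hτ0 (measurable_pot hker hμ.1).aemeasurable
      (energy_lt_top hE hτ.1 hb).ne (hae.mono fun x hx => not_le.1 hx)
  have h1 := h τ hτ
  rw [realEnergy_comm hker hμ hτ.1, realEnergy_comm hker hb hτ.1] at h1
  exact absurd ((ENNReal.toReal_le_toReal (energy_lt_top hE hτ.1 hμ).ne
    (energy_lt_top hE hτ.1 hb).ne).1 h1) (not_le.2 hlt)

omit [T2Space X] [LocallyCompactSpace X] [BorelSpace X] in
lemma exists_minimizing_seq (hE : EnergyPrinciple κ) {μ : Measure X} (hμ : μ ∈ Eplus κ)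
    (A : Set X) :
    ∃ (d : ℝ) (σ : ℕ → Measure X), (∀ n, σ n ∈ compactlyCarried κ A) ∧
      (∀ τ ∈ compactlyCarried κ A, d ≤ sqDist κ μ τ) ∧
      Tendsto (fun n => sqDist κ μ (σ n)) atTop (𝓝 d) := by
  let S : Set ℝ := sqDist κ μ '' compactlyCarried κ A
  have hne : S.Nonempty := ⟨_, 0, zero_mem_compactlyCarried A, rfl⟩
  have hbdd : BddBelow S := by
    refine ⟨0, ?_⟩
    rintro _ ⟨τ, hτ, rfl⟩
    exact sqDist_nonneg hE hμ hτ.1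
  obtain ⟨u, -, hu, huS⟩ := exists_seq_tendsto_sInf hne hbdd
  choose σ hσ hσu using huS
  exact ⟨sInf S, σ, hσ, fun τ hτ => csInf_le hbdd ⟨τ, hτ, rfl⟩, by simpa only [hσu] using hu⟩

/-- The variational inequality for the strong limit of a minimizing sequence. -/
lemma realEnergy_le_of_minimizing (hker : IsKernel κ) (hE : EnergyPrinciple κ)
    {A : Set X} {μ : Measure X} (hμ : μ ∈ Eplus κ)
    {σ : ℕ → Measure X} (hσ : ∀ n, σ n ∈ compactlyCarried κ A) {d : ℝ}
    (hd : ∀ τ ∈ compactlyCarried κ A, d ≤ sqDist κ μ τ)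
    (hlim : Tendsto (fun n => sqDist κ μ (σ n)) atTop (𝓝 d)) {b : Measure X} (hb : b ∈ Eplus κ)
    (hstr : Tendsto (fun n => sqDist κ (σ n) b) atTop (𝓝 0)) :
    ∀ τ ∈ compactlyCarried κ A, realEnergy κ μ τ ≤ realEnergy κ b τ := by
  intro τ hτ
  have hσE : ∀ n, σ n ∈ Eplus κ := fun n => (hσ n).1
  have h1 : ∀ t : ℝ≥0, 0 ≤ 2 * t * (realEnergy κ b τ - realEnergy κ μ τ)
      + t ^ 2 * realEnergy κ τ τ := by
    intro t
    have ht := ((hlim.add (((tendsto_realEnergy hker hE hσE hb hτ.1 hstr).sub_const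
      (realEnergy κ μ τ)).const_mul (2 * (t : ℝ)))).add_const ((t : ℝ) ^ 2 * realEnergy κ τ τ))
    have := ge_of_tendsto (b := d) ht (Eventually.of_forall fun n => by
      have hmem := add_mem_compactlyCarried hker hE _ (hσ n) _
        (smul_mem_compactlyCarried hker t τ hτ)
      have := hd _ hmem
      rwa [sqDist_comm hker hμ hmem.1, sqDist_add_smul_left hker hE (hσE n) hμ hτ.1,
        sqDist_comm hker (hσE n) hμ] at this)
    linarith
  by_contra! hlt
  have hk := realEnergy_nonneg (κ := κ) τ τ
  set a := realEnergy κ μ τ - realEnergy κ b τ with ha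
  have ha0 : 0 < a := by linarith
  have ht0 : 0 < a / (realEnergy κ τ τ + 1) := by positivity
  obtain ⟨s, hs⟩ : ∃ s : ℝ≥0, (s : ℝ) = a / (realEnergy κ τ τ + 1) := ⟨⟨_, ht0.le⟩, rfl⟩
  have h2 := h1 s
  rw [hs] at h2
  set t := a / (realEnergy κ τ τ + 1) with htdef
  have h3 : t * (realEnergy κ τ τ + 1) = a := by
    rw [htdef]; field_simp
  have h4 : realEnergy κ b τ - realEnergy κ μ τ = -a := by rw [ha]; ring
  rw [h4] at h2
  nlinarith [mul_pos ht0 ha0, mul_pos ht0 ht0]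

/-- Balayage onto a compact set: the projection onto the cone of measures carried by `K`. -/
lemma exists_projection_isCompact (hker : IsKernel κ) (hE : EnergyPrinciple κ) (hC : Consistent κ)
    (hD : Domination κ) {K : Set X} (hK : IsCompact K) {μ : Measure X} (hμ : μ ∈ Eplus κ) :
    ∃ b ∈ compactlyCarried κ K, (∀ τ ∈ compactlyCarried κ K, sqDist κ μ b ≤ sqDist κ μ τ) ∧
      ∀ θ ∈ Eplus κ, (∀ τ ∈ compactlyCarried κ K, ∀ᵐ x ∂τ, pot κ μ x ≤ pot κ θ x) →
        ∀ x, pot κ b x ≤ pot κ θ x := by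
  obtain ⟨d, σ, hσ, hd, hlim⟩ := exists_minimizing_seq hE hμ K
  obtain ⟨b, hb, ⟨G, hG⟩, hstr⟩ := exists_limit_of_minimizing hker hE hC
    (compactlyCarried_subset K) (add_mem_compactlyCarried hker hE)
    (smul_mem_compactlyCarried hker) hμ hσ hd hlim
  have hσE : ∀ n, σ n ∈ Eplus κ := fun n => (hσ n).1
  have hKopen : IsOpen Kᶜ := hK.isClosed.isOpen_compl
  have hbK : b Kᶜ = 0 := by
    have h := lintegral_le_of_vagueConv (fun n => (hσE n).1) hb.1 hG (c := 0)
      (hKopen.lowerSemicontinuous_indicator (zero_le (a := (1 : ℝ≥0∞)))) (fun n => by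
        obtain ⟨-, L, hLK, -, hL0⟩ := hσ n
        rw [lintegral_indicator hKopen.measurableSet]
        simp [measure_mono_null (compl_subset_compl.2 hLK) hL0])
    rw [lintegral_indicator hKopen.measurableSet] at h
    simpa using h
  have hbC : b ∈ compactlyCarried κ K := ⟨hb, K, subset_rfl, hK, hbK⟩
  have hvar := realEnergy_le_of_minimizing hker hE hμ hσ hd hlim hb hstr
  have hmin : sqDist κ μ b = d := by
    refine tendsto_nhds_unique ?_ hlim
    have h1 := tendsto_realEnergy hker hE hσE hb hμ hstr
    have h2 := tendsto_realEnergy_self hker hE hσE hb hstr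
    have h3 := ((h1.const_mul 2).const_sub (realEnergy κ μ μ)).add h2
    rw [realEnergy_comm hker hb hμ] at h3
    exact h3.congr fun n => by rw [sqDist, realEnergy_comm hker (hσE n) hμ]
  have hle : realEnergy κ b b ≤ realEnergy κ μ b := by
    have h1 : ∀ c : ℝ≥0, (c : ℝ) < 1 →
        (c + 1) * realEnergy κ b b - 2 * realEnergy κ μ b ≤ 0 := by
      intro c hc
      have h := hd _ (smul_mem_compactlyCarried hker c b hbC)
      rw [← hmin] at h
      simp only [sqDist, realEnergy_smul_right hker c hμ hb, realEnergy_smul_left,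
        realEnergy_smul_right hker c hb hb] at h
      by_contra! hpos
      nlinarith [mul_pos (sub_pos.2 hc) hpos]
    by_contra! hlt
    have hbb := realEnergy_nonneg (κ := κ) b b
    have hμb := realEnergy_nonneg (κ := κ) μ b
    have hb0 : 0 < realEnergy κ b b := by linarith
    obtain ⟨s, hs⟩ : ∃ s : ℝ≥0, (s : ℝ) = realEnergy κ μ b / realEnergy κ b b :=
      ⟨⟨_, div_nonneg hμb hbb⟩, rfl⟩
    have h2 := h1 s (hs ▸ (div_lt_one hb0).2 hlt)
    rw [hs, add_mul, div_mul_cancel₀ _ hb0.ne'] at h2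
    linarith
  have hNE := NEOn_of_realEnergy_le hker hE hμ hb hvar
  have hae : ∀ᵐ x ∂b, pot κ μ x ≤ pot κ b x :=
    hNE.ae hker (measurableSet_not_pot_le hker hμ.1 hb.1) hbC
  have hle' : energy κ b b ≤ energy κ b μ := by
    rw [realEnergy_comm hker hμ hb] at hle
    exact (ENNReal.toReal_le_toReal hb.2.ne (energy_lt_top hE hb hμ).ne).1 hle
  have heq : pot κ μ =ᵐ[b] pot κ b :=
    ae_eq_of_ae_le_of_lintegral_le hae (energy_lt_top hE hb hμ).ne
      (measurable_pot hker hb.1).aemeasurable hle'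
  refine ⟨b, hbC, fun τ hτ => hmin.trans_le (hd τ hτ), fun θ hθ h => hD b hb θ hθ ?_⟩
  filter_upwards [heq, h b hbC] with x h1 h2
  rwa [← h1]

/-- Existence of the inner balayage, as a strong limit of measures carried by compact subsets. -/
lemma exists_isInnerBal (hker : IsKernel κ) (hE : EnergyPrinciple κ) (hC : Consistent κ)
    (hD : Domination κ) (A : Set X) {μ : Measure X} (hμ : μ ∈ Eplus κ) :
    ∃ b, IsInnerBal κ A μ b ∧ ∃ σ : ℕ → Measure X, (∀ n, σ n ∈ compactlyCarried κ A) ∧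
      Tendsto (fun n => sqDist κ (σ n) b) atTop (𝓝 0) := by
  obtain ⟨d, σ, hσ, hd, hlim⟩ := exists_minimizing_seq hE hμ A
  choose K hKA hK hσK using fun n => (hσ n).2
  choose b' hb'C hb'min hb'pot using fun n => exists_projection_isCompact hker hE hC hD (hK n) hμ
  have hb'A : ∀ n, b' n ∈ compactlyCarried κ A := fun n => compactlyCarried_mono (hKA n) (hb'C n)
  have hlim' : Tendsto (fun n => sqDist κ μ (b' n)) atTop (𝓝 d) :=
    tendsto_of_tendsto_of_tendsto_of_le_of_le tendsto_const_nhds hlim (fun n => hd _ (hb'A n))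
      fun n => hb'min n _ ⟨(hσ n).1, K n, subset_rfl, hK n, hσK n⟩
  obtain ⟨b, hb, ⟨G, hG⟩, hstr⟩ := exists_limit_of_minimizing hker hE hC
    (compactlyCarried_subset A) (add_mem_compactlyCarried hker hE)
    (smul_mem_compactlyCarried hker) hμ hb'A hd hlim'
  have hvar := realEnergy_le_of_minimizing hker hE hμ hb'A hd hlim' hb hstr
  refine ⟨b, ⟨⟨hb, NEOn_of_realEnergy_le hker hE hμ hb hvar⟩, ?_⟩, b', hb'A, hstr⟩
  rintro θ ⟨hθ, hθNE⟩ x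
  have hlsc : LowerSemicontinuous (κ x) := hker.lsc.comp (g := fun y => (x, y)) (by fun_prop)
  refine lintegral_le_of_vagueConv (fun n => (hb'C n).1.1) hb.1 hG hlsc fun n => ?_
  exact hb'pot n θ hθ (fun τ hτ => hθNE.ae hker (measurableSet_not_pot_le hker hμ.1 hθ.1)
    (compactlyCarried_mono (hKA n) hτ)) x

lemma IsInnerBal.unique (hker : IsKernel κ) (hE : EnergyPrinciple κ) {A : Set X}
    {μ b b' : Measure X} (hb : IsInnerBal κ A μ b) (hb' : IsInnerBal κ A μ b') : b = b' := by
  have hpot : pot κ b = pot κ b' :=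
    funext fun x => le_antisymm (hb.2 b' hb'.1 x) (hb'.2 b hb.1 x)
  have h1 : energy κ b b = energy κ b b' := by rw [energy, energy, hpot]
  have h2 : energy κ b' b = energy κ b' b' := by rw [energy, energy, hpot]
  refine (hE _ hb.1.1 _ hb'.1.1).2 ?_
  rw [h1, ← h2, energy_comm hker hb'.1.1.1 hb.1.1.1, two_mul]

/-- The potentials of `ν` and its balayage have the same energy against every balayage. -/
lemma IsInnerBal.energy_eq (hker : IsKernel κ) (hE : EnergyPrinciple κ) (hC : Consistent κ)
    (hD : Domination κ) {A : Set X} {μ ν bμ bν : Measure X} (hμ : μ ∈ Eplus κ) (hν : ν ∈ Eplus κ)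
    (hbμ : IsInnerBal κ A μ bμ) (hbν : IsInnerBal κ A ν bν) :
    energy κ bμ ν = energy κ bμ bν := by
  obtain ⟨b, hb, σ, hσ, hstr⟩ := exists_isInnerBal hker hE hC hD A hμ
  obtain rfl := hbμ.unique hker hE hb
  have hbE := hbμ.1.1
  have hσE : ∀ n, σ n ∈ Eplus κ := fun n => (hσ n).1
  have hνΛ : ν ∈ InnerLam κ A ν := ⟨hν, by
    refine NEOn_of_realEnergy_le hker hE hν hν fun τ _ => le_rfl⟩
  have hσeq : ∀ n, realEnergy κ (σ n) ν = realEnergy κ (σ n) bν := by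
    intro n
    have : energy κ (σ n) ν = energy κ (σ n) bν := by
      refine lintegral_congr_ae ?_
      filter_upwards [hbν.1.2.ae hker (measurableSet_not_pot_le hker hν.1 hbν.1.1.1) (hσ n)]
        with x hx
      exact le_antisymm hx (hbν.2 ν hνΛ x)
    rw [realEnergy, this, realEnergy]
  have h := tendsto_nhds_unique (tendsto_realEnergy hker hE hσE hbE hν hstr)
    ((tendsto_realEnergy hker hE hσE hbE hbν.1.1 hstr).congr fun n => (hσeq n).symm)
  exact (ENNReal.toReal_eq_toReal_iff' (energy_lt_top hE hbE hν).ne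
    (energy_lt_top hE hbE hbν.1.1).ne).1 h

end Swept

/-- The symmetry relation `κ(μ^A, ν) = κ(μ, ν^A)`, and the fact that it determines
the inner balayage uniquely. -/
theorem statement11 (κ : X → X → ℝ≥0∞) (hker : IsKernel κ)
    (hE : EnergyPrinciple κ) (hC : Consistent κ) (hD : Domination κ) (A : Set X) :
    (∀ μ ∈ Eplus κ, ∀ ν ∈ Eplus κ, ∀ bμ bν : Measure X,
      IsInnerBal κ A μ bμ → IsInnerBal κ A ν bν →
        energy κ bμ ν = energy κ μ bν) ∧
    (∀ μ ∈ Eplus κ, ∀ bμ : Measure X, IsInnerBal κ A μ bμ →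
      ∀ ξ ∈ Eplus κ,
        (∀ ν ∈ Eplus κ, ∀ bν : Measure X, IsInnerBal κ A ν bν →
          energy κ ξ ν = energy κ μ bν) → ξ = bμ) := by
  have hsymm : ∀ μ ∈ Eplus κ, ∀ ν ∈ Eplus κ, ∀ bμ bν : Measure X,
      IsInnerBal κ A μ bμ → IsInnerBal κ A ν bν → energy κ bμ ν = energy κ μ bν := by
    intro μ hμ ν hν bμ bν hbμ hbν
    rw [hbμ.energy_eq hker hE hC hD hμ hν hbν, energy_comm hker hμ.1 hbν.1.1.1,
      hbν.energy_eq hker hE hC hD hν hμ hbμ, energy_comm hker hbμ.1.1.1 hbν.1.1.1]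
  refine ⟨hsymm, fun μ hμ bμ hbμ ξ hξ h => ?_⟩
  have hbE := hbμ.1.1
  have key : ∀ ν ∈ Eplus κ, energy κ ξ ν = energy κ bμ ν := by
    intro ν hν
    obtain ⟨bν, hbν, -⟩ := exists_isInnerBal hker hE hC hD A hν
    rw [h ν hν bν hbν, hsymm μ hμ ν hν bμ bν hbμ hbν]
  refine (hE ξ hξ bμ hbE).2 ?_
  rw [key ξ hξ, key bμ hbE, energy_comm hker hbE.1 hξ.1, key bμ hbE, two_mul]

end Balayage
end

section
/- Let X be a locally compact Hausdorff space whose topology has a countable base. Then there exists a countable set S of continuous compactly supported functions f : X → ℝ that is dense in C_c(X) for the inductive limit topology; concretely: for every continuous compactly supported f : X → ℝ there exist a compact set K ⊂ X and a sequence (f_j) of elements of S such that the support of every f_j is contained in K and f_j → f uniformly on X. -/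
open MeasureTheory Filter Topology Set
open scoped ENNReal NNReal

namespace Balayage

variable {X : Type*} [TopologicalSpace X] [T2Space X] [LocallyCompactSpace X]
  [MeasurableSpace X] [BorelSpace X]

/-- For second-countable locally compact `X`, there is a countable subset of `C_c(X)`
dense for the inductive limit topology. -/
theorem statement13 [SecondCountableTopology X] :
    ∃ S : Set (X → ℝ), S.Countable ∧
      (∀ f ∈ S, Continuous f ∧ HasCompactSupport f) ∧
      ∀ f : X → ℝ, Continuous f → HasCompactSupport f →
        ∃ K : Set X, IsCompact K ∧ ∃ g : ℕ → X → ℝ,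
          (∀ j, g j ∈ S) ∧ (∀ j, tsupport (g j) ⊆ K) ∧
          TendstoUniformly g f atTop := by
  obtain ⟨D, D_countable, D_dense⟩ := TopologicalSpace.exists_countable_dense C(X, ℝ)
  let E : CompactExhaustion X := default
  have cutoff (n : ℕ) : ∃ φ : C(X, ℝ), EqOn φ 1 (E n) ∧ HasCompactSupport φ ∧
      ∀ x, φ x ∈ Icc (0 : ℝ) 1 := by
    obtain ⟨φ, h_one, -, h_supp, h_mem⟩ :=
      exists_continuous_one_zero_of_isCompact (E.isCompact n) isClosed_empty (disjoint_empty _)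
    exact ⟨φ, h_one, h_supp, h_mem⟩
  choose φ φ_one φ_supp φ_mem using cutoff
  refine ⟨⋃ n, (fun d : C(X, ℝ) => ⇑(φ n) * ⇑d) '' D,
    countable_iUnion fun n => D_countable.image _, ?_, ?_⟩
  · simp only [mem_iUnion, mem_image]
    rintro _ ⟨n, d, -, rfl⟩
    exact ⟨(φ n).continuous.mul d.continuous, (φ_supp n).mul_right⟩
  · intro f f_cont f_supp
    obtain ⟨n, hn⟩ := E.exists_superset_of_isCompact f_supp
    obtain ⟨d, d_mem, d_lim⟩ := mem_closure_iff_seq_limit.1 (D_dense ⟨f, f_cont⟩)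
    refine ⟨tsupport (φ n), φ_supp n, fun j => φ n * d j,
      fun j => mem_iUnion.2 ⟨n, d j, d_mem j, rfl⟩, fun j => tsupport_mul_subset_left, ?_⟩
    have d_unif := ContinuousMap.tendsto_iff_forall_isCompact_tendstoUniformlyOn.1 d_lim
      (tsupport (φ n)) (φ_supp n)
    rw [Metric.tendstoUniformlyOn_iff] at d_unif
    rw [Metric.tendstoUniformly_iff]
    intro ε hε
    filter_upwards [d_unif ε hε] with j hj x
    have f_eq : f x = φ n x * f x := by
      by_cases hx : x ∈ tsupport f
      · simp [φ_one n (hn hx)]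
      · simp [image_eq_zero_of_notMem_tsupport hx]
    rw [f_eq, Pi.mul_apply, Real.dist_eq, ← mul_sub, abs_mul, abs_of_nonneg (φ_mem n x).1]
    by_cases hx : x ∈ tsupport (φ n)
    · calc φ n x * |f x - d j x| ≤ 1 * |f x - d j x| := by gcongr; exact (φ_mem n x).2
        _ < ε := by simpa [Real.dist_eq] using hj x hx
    · simpa [image_eq_zero_of_notMem_tsupport hx] using hε

end Balayage
end
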